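/- Let k be a field of characteristic not 2, K a field extension of k, and s ∈ K with s² = α for some nonzero α ∈ k and s not in the image of k. Let n ≥ 1 and suppose A, B ∈ Sp(2n,K) both satisfy A² = I and B² = I, and every entry of A and every entry of B is a k-multiple of s. Then there exists Q ∈ Sp(2n,k) such that, viewing Q over K, Q⁻¹AQ = B. That is, the Type 2 involutions Inn_A and Inn_B associated to the same square class α are isomorphic over Sp(2n,k). -/

import Mathlib

open Matrix

/-- The standard symplectic form matrix `J = [[0, Iₙ], [-Iₙ, 0]]`. -/
def SpJ (n : ℕ) (R : Type*) [CommRing R] : Matrix (Fin n ⊕ Fin n) (Fin n ⊕ Fin n) R :=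
  Matrix.fromBlocks 0 1 (-1) 0

/-- `M` belongs to the symplectic group `Sp(2n,R)`, i.e. `Mᵀ J M = J`. -/
def IsSymp {n : ℕ} {R : Type*} [CommRing R]
    (M : Matrix (Fin n ⊕ Fin n) (Fin n ⊕ Fin n) R) : Prop :=
  Mᵀ * SpJ n R * M = SpJ n R

/-- `β` is a nondegenerate alternating form and `T` is a `β`-self-adjoint endomorphism
with `T² = a`. -/
structure IsSymplecticSqrt {k V : Type*} [Field k] [AddCommGroup V] [Module k V]
    (a : k) (β : V →ₗ[k] V →ₗ[k] k) (T : V →ₗ[k] V) : Prop where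
  alt : ∀ v, β v v = 0
  nondeg : ∀ v, (∀ w, β v w = 0) → v = 0
  sq : ∀ v, T (T v) = a • v
  selfAdj : ∀ v w, β (T v) w = β v (T w)

namespace IsSymplecticSqrt

section Field

variable {k V : Type*} [Field k] [AddCommGroup V] [Module k V]

/-- The pairings of a vector with `y`, `T y`, `x` and `T x`. -/
def coords (β : V →ₗ[k] V →ₗ[k] k) (T : V →ₗ[k] V) (x y : V) : V →ₗ[k] k × k × k × k :=
  (β.flip y).prod ((β.flip (T y)).prod ((β x).prod (β (T x))))

@[simp]
lemma coords_apply (β : V →ₗ[k] V →ₗ[k] k) (T : V →ₗ[k] V) (x y v : V) :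
    coords β T x y v = (β v y, β v (T y), β x v, β (T x) v) := rfl

/-- The combination of `x`, `T x`, `y`, `T y` with prescribed `coords`, when `β x y = 1` and
`β (T x) y = 0`. -/
def ofCoords (a : k) (T : V →ₗ[k] V) (x y : V) : k × k × k × k →ₗ[k] V where
  toFun c := c.1 • x + (a⁻¹ * c.2.1) • T x + c.2.2.1 • y + (a⁻¹ * c.2.2.2) • T y
  map_add' b c := by simp only [Prod.fst_add, Prod.snd_add]; module
  map_smul' r c := by
    simp only [Prod.smul_fst, Prod.smul_snd, smul_eq_mul, RingHom.id_apply]; module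

lemma ofCoords_apply (a : k) (T : V →ₗ[k] V) (x y : V) (c : k × k × k × k) :
    ofCoords a T x y c =
      c.1 • x + (a⁻¹ * c.2.1) • T x + c.2.2.1 • y + (a⁻¹ * c.2.2.2) • T y := rfl

variable {a : k} {β : V →ₗ[k] V →ₗ[k] k} {T : V →ₗ[k] V}

lemma swap (h : IsSymplecticSqrt a β T) (v w : V) : β v w = -β w v := by
  have := h.alt (v + w)
  simp only [map_add, LinearMap.add_apply, h.alt, zero_add, add_zero] at this
  linear_combination this

lemma apply_self (h : IsSymplecticSqrt a β T) (h2 : (2 : k) ≠ 0) (v : V) : β v (T v) = 0 := by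
  have h₁ := h.selfAdj v v
  have h₂ := h.swap v (T v)
  refine (mul_eq_zero.1 (?_ : (2 : k) * β v (T v) = 0)).resolve_left h2
  linear_combination h₂ - h₁

lemma exists_pair (h : IsSymplecticSqrt a β T) (ha : ∀ c : k, c * c ≠ a) {x : V} (hx : x ≠ 0) :
    ∃ y, β x y = 1 ∧ β (T x) y = 0 := by
  obtain ⟨z, hz⟩ : ∃ z, β x z ≠ 0 := by
    by_contra! hz
    exact hx (h.nondeg x hz)
  have hD : a * β x z * β x z - β x (T z) * β x (T z) ≠ 0 := fun hD =>
    ha (β x (T z) / β x z) (by field_simp; linear_combination -hD)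
  refine ⟨(a * β x z * β x z - β x (T z) * β x (T z))⁻¹ • ((a * β x z) • z - β x (T z) • T z),
    ?_, ?_⟩
  · simp only [map_smul, map_sub, smul_eq_mul]
    exact inv_mul_cancel₀ hD
  · simp only [map_smul, map_sub, smul_eq_mul, h.selfAdj, h.sq]
    ring

lemma coords_map (h : IsSymplecticSqrt a β T) (x y v : V) :
    coords β T x y (T v) = (β v (T y), a * β v y, β (T x) v, a * β x v) := by
  simp [h.selfAdj, h.sq]

lemma map_ofCoords (h : IsSymplecticSqrt a β T) (ha0 : a ≠ 0) (x y : V) (b₁ b₂ b₃ b₄ : k) :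
    T (ofCoords a T x y (b₁, b₂, b₃, b₄)) = ofCoords a T x y (b₂, a * b₁, b₄, a * b₃) := by
  simp only [ofCoords_apply, map_add, map_smul, h.sq, smul_smul]
  rw [mul_right_comm, mul_right_comm a⁻¹ b₄, inv_mul_cancel_left₀ ha0, inv_mul_cancel_left₀ ha0,
    inv_mul_cancel₀ ha0]
  module

variable {x y : V}

lemma coords_ofCoords (h : IsSymplecticSqrt a β T) (h2 : (2 : k) ≠ 0) (ha0 : a ≠ 0)
    (hxy : β x y = 1) (hTxy : β (T x) y = 0) (c : k × k × k × k) :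
    coords β T x y (ofCoords a T x y c) = c := by
  have hxTy : β x (T y) = 0 := by rw [← h.selfAdj, hTxy]
  obtain ⟨c₁, c₂, c₃, c₄⟩ := c
  simp [ofCoords_apply, h.selfAdj, h.sq, h.alt, h.apply_self h2, hxy, hxTy, ha0,
    mul_comm]

lemma apply_ofCoords (h : IsSymplecticSqrt a β T) (c : k × k × k × k) (v : V) :
    β (ofCoords a T x y c) v =
      c.1 * (coords β T x y v).2.2.1 + a⁻¹ * c.2.1 * (coords β T x y v).2.2.2
        - c.2.2.1 * (coords β T x y v).1 - a⁻¹ * c.2.2.2 * (coords β T x y v).2.1 := by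
  simp only [ofCoords_apply, coords_apply, map_add, map_smul, LinearMap.add_apply,
    LinearMap.smul_apply, smul_eq_mul, h.swap v y, h.swap v (T y)]
  ring

/-- The restriction to the orthogonal complement of `x`, `T x`, `y`, `T y`. -/
lemma restrict_ker_coords (h : IsSymplecticSqrt a β T) (h2 : (2 : k) ≠ 0) (ha0 : a ≠ 0)
    (hxy : β x y = 1) (hTxy : β (T x) y = 0)
    (hT : ∀ v ∈ LinearMap.ker (coords β T x y), T v ∈ LinearMap.ker (coords β T x y)) :
    IsSymplecticSqrt a (β.domRestrict₁₂ (LinearMap.ker (coords β T x y))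
      (LinearMap.ker (coords β T x y))) (T.restrict hT) where
  alt v := h.alt v
  nondeg := by
    rintro ⟨u, hu⟩ hw
    refine Subtype.ext (h.nondeg u fun v => ?_)
    have h₁ : v - ofCoords a T x y (coords β T x y v) ∈ LinearMap.ker (coords β T x y) := by
      rw [LinearMap.mem_ker, map_sub, h.coords_ofCoords h2 ha0 hxy hTxy, sub_self]
    have h₂ : β u (v - ofCoords a T x y (coords β T x y v)) = 0 := hw ⟨_, h₁⟩
    rw [map_sub, h.swap u (ofCoords a T x y _), h.apply_ofCoords, LinearMap.mem_ker.1 hu] at h₂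
    simpa using h₂
  sq v := Subtype.ext (h.sq v)
  selfAdj v w := h.selfAdj v w

lemma map_mem_ker_coords (h : IsSymplecticSqrt a β T) (v : V)
    (hv : v ∈ LinearMap.ker (coords β T x y)) : T v ∈ LinearMap.ker (coords β T x y) := by
  rw [LinearMap.mem_ker] at hv ⊢
  rw [h.coords_map]
  simp only [coords_apply, Prod.mk_eq_zero] at hv
  simp [hv]

lemma finrank_ker_coords [FiniteDimensional k V] (h : IsSymplecticSqrt a β T) (h2 : (2 : k) ≠ 0)
    (ha0 : a ≠ 0) (hxy : β x y = 1) (hTxy : β (T x) y = 0) :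
    Module.finrank k (LinearMap.ker (coords β T x y)) + 4 = Module.finrank k V := by
  have hs : Function.Surjective (coords β T x y) := fun c =>
    ⟨_, h.coords_ofCoords h2 ha0 hxy hTxy c⟩
  rw [← LinearMap.finrank_range_add_finrank_ker (coords β T x y), LinearMap.range_eq_top.2 hs]
  simp [add_comm]

end Field

universe u v w

lemma exists_isometry {k : Type u} [Field k] {a : k} (h2 : (2 : k) ≠ 0) (ha : ∀ c : k, c * c ≠ a)
    {V : Type v} {V' : Type w} [AddCommGroup V] [Module k V] [FiniteDimensional k V]
    [AddCommGroup V'] [Module k V'] [FiniteDimensional k V']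
    {β : V →ₗ[k] V →ₗ[k] k} {T : V →ₗ[k] V} {β' : V' →ₗ[k] V' →ₗ[k] k} {T' : V' →ₗ[k] V'}
    (h : IsSymplecticSqrt a β T) (h' : IsSymplecticSqrt a β' T')
    (hd : Module.finrank k V ≤ Module.finrank k V') :
    ∃ f : V →ₗ[k] V', (∀ v w, β' (f v) (f w) = β v w) ∧ ∀ v, f (T v) = T' (f v) := by
  induction hn : Module.finrank k V using Nat.strong_induction_on generalizing V V' with
  | _ n ih =>
  have ha0 : a ≠ 0 := fun h0 => ha 0 (by simp [h0])
  rcases subsingleton_or_nontrivial V with hV | hV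
  · exact ⟨0, fun v w => by simp [Subsingleton.elim v 0], by simp⟩
  have hV' : Nontrivial V' := Module.finrank_pos_iff.1 (Module.finrank_pos.trans_le hd)
  obtain ⟨x, hx⟩ := exists_ne (0 : V)
  obtain ⟨x', hx'⟩ := exists_ne (0 : V')
  obtain ⟨y, hxy, hTxy⟩ := h.exists_pair ha hx
  obtain ⟨y', hxy', hTxy'⟩ := h'.exists_pair ha hx'
  have hr := h.finrank_ker_coords h2 ha0 hxy hTxy
  have hr' := h'.finrank_ker_coords h2 ha0 hxy' hTxy'
  obtain ⟨g, hg, hgT⟩ := ih _ (by omega)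
    (h.restrict_ker_coords h2 ha0 hxy hTxy h.map_mem_ker_coords)
    (h'.restrict_ker_coords h2 ha0 hxy' hTxy' h'.map_mem_ker_coords) (by omega) rfl
  let S := ofCoords a T x y
  let Φ := coords β T x y
  let S' := ofCoords a T' x' y'
  let Φ' := coords β' T' x' y'
  have hΦS : ∀ c, Φ (S c) = c := h.coords_ofCoords h2 ha0 hxy hTxy
  have hΦS' : ∀ c, Φ' (S' c) = c := h'.coords_ofCoords h2 ha0 hxy' hTxy'
  let q : V →ₗ[k] LinearMap.ker Φ := (LinearMap.id - S ∘ₗ Φ).codRestrict _ fun v => by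
    simp [LinearMap.mem_ker, map_sub, hΦS]
  have hv : ∀ v, v = S (Φ v) + (q v : V) := fun v => by simp [q]
  have hST : ∀ v, S (Φ (T v)) = T (S (Φ v)) := fun v => by
    simp only [S, Φ, h.coords_map, coords_apply, h.map_ofCoords ha0]
  have hST' : ∀ v, S' (Φ (T v)) = T' (S' (Φ v)) := fun v => by
    simp only [S', Φ, h.coords_map, coords_apply, h'.map_ofCoords ha0]
  have hqT : ∀ v, q (T v) = T.restrict h.map_mem_ker_coords (q v) := fun v =>
    Subtype.ext (by simp [q, hST])
  have hker : ∀ c, ∀ u ∈ LinearMap.ker Φ, β (S c) u = 0 := fun c u hu => by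
    simp only [S, h.apply_ofCoords]
    rw [show coords β T x y u = 0 from hu]; simp
  have hker' : ∀ c, ∀ u ∈ LinearMap.ker Φ', β' (S' c) u = 0 := fun c u hu => by
    simp only [S', h'.apply_ofCoords]
    rw [show coords β' T' x' y' u = 0 from hu]; simp
  have hSS : ∀ b c, β' (S' b) (S' c) = β (S b) (S c) := fun b c => by
    simp only [S, S', h.apply_ofCoords, h'.apply_ofCoords]
    rw [h.coords_ofCoords h2 ha0 hxy hTxy, h'.coords_ofCoords h2 ha0 hxy' hTxy']
  refine ⟨S' ∘ₗ Φ + (LinearMap.ker Φ').subtype ∘ₗ g ∘ₗ q, fun v w => ?_, fun v => ?_⟩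
  · have hgq : β' (g (q v)) (g (q w)) = β (q v) (q w) := hg (q v) (q w)
    conv_rhs => rw [hv v, hv w]
    simp only [LinearMap.add_apply, LinearMap.comp_apply, Submodule.subtype_apply, map_add]
    rw [hSS, hker _ _ (q w).2, hker' _ _ (g (q w)).2, h.swap (q v), h'.swap (g (q v)) (S' _),
      hker _ _ (q v).2, hker' _ _ (g (q v)).2, hgq]
  · simp only [LinearMap.add_apply, LinearMap.comp_apply, Submodule.subtype_apply, map_add, hST',
      hqT, hgT]
    rfl

end IsSymplecticSqrt

lemma SpJ_map {k K : Type*} [Field k] [Field K] [Algebra k K] (n : ℕ) :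
    (SpJ n k).map (algebraMap k K) = SpJ n K := by
  simp [SpJ, Matrix.fromBlocks_map, Matrix.map_neg]

lemma SpJ_mul_self (n : ℕ) (R : Type*) [CommRing R] : SpJ n R * SpJ n R = -1 := by
  simp [SpJ, Matrix.fromBlocks_multiply, ← Matrix.fromBlocks_one, Matrix.fromBlocks_neg]

lemma IsSymp.isUnit_det {n : ℕ} {R : Type*} [CommRing R]
    {M : Matrix (Fin n ⊕ Fin n) (Fin n ⊕ Fin n) R} (hM : IsSymp M) : IsUnit M.det := by
  refine Matrix.isUnit_det_of_left_inverse (B := -SpJ n R * Mᵀ * SpJ n R) ?_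
  rw [Matrix.mul_assoc, Matrix.mul_assoc, ← Matrix.mul_assoc Mᵀ, hM, Matrix.neg_mul, SpJ_mul_self,
    neg_neg]

/-- A symplectic involution with entries in `k s` is `s` times a self-adjoint square root of
`α⁻¹` over `k`. -/
lemma IsSymp.exists_isSymplecticSqrt {k K : Type*} [Field k] [Field K] [Algebra k K]
    {s : K} {α : k} (hα : α ≠ 0) (hs : s ^ 2 = algebraMap k K α) {n : ℕ}
    {A : Matrix (Fin n ⊕ Fin n) (Fin n ⊕ Fin n) K} (hA : IsSymp A) (hA2 : A * A = 1)
    (hAent : ∀ i j, ∃ c : k, A i j = algebraMap k K c * s) :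
    ∃ A₀ : Matrix (Fin n ⊕ Fin n) (Fin n ⊕ Fin n) k, A = s • A₀.map (algebraMap k K) ∧
      IsSymplecticSqrt α⁻¹ (Matrix.toLinearMap₂' k (SpJ n k)) (Matrix.toLin' A₀) := by
  choose c hc using hAent
  have hAc : A = s • (Matrix.of c).map (algebraMap k K) := by
    ext i j; simp [hc, mul_comm]
  have hinj : Function.Injective fun M : Matrix (Fin n ⊕ Fin n) (Fin n ⊕ Fin n) k =>
      M.map (algebraMap k K) := Matrix.map_injective (algebraMap k K).injective
  have hss : s * s = algebraMap k K α := by rw [← hs, sq]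
  have hsq : α • (Matrix.of c * Matrix.of c) = 1 := by
    apply hinj
    simp only
    rw [Matrix.map_smul' _ _ _ (map_mul _), Matrix.map_mul,
      Matrix.map_one _ (map_zero _) (map_one _), ← hA2, hAc,
      Matrix.smul_mul, Matrix.mul_smul, smul_smul, hss]
  have hAJ : Aᵀ * SpJ n K = SpJ n K * A := by
    rw [← Matrix.mul_one (Aᵀ * _), ← hA2, ← Matrix.mul_assoc, hA]
  have hs0 : s ≠ 0 := fun h0 => hα (by simpa [h0] using hs.symm)
  have hadj : (Matrix.of c)ᵀ * SpJ n k = SpJ n k * Matrix.of c := by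
    apply hinj
    simp only
    rw [Matrix.map_mul, Matrix.map_mul, SpJ_map, Matrix.transpose_map]
    rw [hAc, Matrix.transpose_smul, Matrix.smul_mul, Matrix.mul_smul] at hAJ
    exact smul_right_injective _ hs0 hAJ
  have hself : ∀ v, v ⬝ᵥ (SpJ n k) *ᵥ v = 0 := fun v => by
    obtain ⟨v₁, v₂, rfl⟩ : ∃ v₁ v₂, v = Sum.elim v₁ v₂ :=
      ⟨_, _, (Sum.elim_comp_inl_inr v).symm⟩
    simp [SpJ, Matrix.fromBlocks_mulVec, Matrix.neg_mulVec, dotProduct_comm v₂ v₁]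
  refine ⟨Matrix.of c, hAc, fun v => ?_, fun v hv => ?_, fun v => ?_, fun v w => ?_⟩
  · rw [Matrix.toLinearMap₂'_apply', hself]
  · simp only [Matrix.toLinearMap₂'_apply', Matrix.dotProduct_mulVec] at hv
    have h0 : v ᵥ* SpJ n k = 0 := dotProduct_eq_zero _ hv
    have h1 : (v ᵥ* SpJ n k) ᵥ* SpJ n k = 0 := by rw [h0, Matrix.zero_vecMul]
    rwa [Matrix.vecMul_vecMul, SpJ_mul_self, Matrix.vecMul_neg, Matrix.vecMul_one,
      neg_eq_zero] at h1
  · rw [Matrix.toLin'_apply, Matrix.toLin'_apply, Matrix.mulVec_mulVec,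
      (eq_inv_smul_iff₀ hα).2 hsq, Matrix.smul_mulVec, Matrix.one_mulVec]
  · rw [Matrix.toLinearMap₂'_apply', Matrix.toLinearMap₂'_apply', Matrix.toLin'_apply,
      Matrix.toLin'_apply, Matrix.mulVec_mulVec, ← hadj, ← Matrix.mulVec_mulVec,
      Matrix.dotProduct_mulVec v, Matrix.vecMul_transpose]

/-- Two Type 2 involutions associated to the same square class `α` are isomorphic over
`Sp(2n,k)`: the inducing matrices are conjugate by a symplectic matrix over `k`. -/
theorem stmt10 {k K : Type*} [Field k] [Field K] [Algebra k K]
    (hchar : (2 : k) ≠ 0) (s : K) (α : k) (hα : α ≠ 0) (hs : s ^ 2 = algebraMap k K α)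
    (hsk : s ∉ Set.range (algebraMap k K)) {n : ℕ} (hn : 1 ≤ n)
    (A B : Matrix (Fin n ⊕ Fin n) (Fin n ⊕ Fin n) K) (hA : IsSymp A) (hB : IsSymp B)
    (hA2 : A * A = 1) (hB2 : B * B = 1)
    (hAent : ∀ i j, ∃ c : k, A i j = algebraMap k K c * s)
    (hBent : ∀ i j, ∃ c : k, B i j = algebraMap k K c * s) :
    ∃ Q : Matrix (Fin n ⊕ Fin n) (Fin n ⊕ Fin n) k, IsSymp Q ∧
      (Q.map (algebraMap k K))⁻¹ * A * Q.map (algebraMap k K) = B := by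
  obtain ⟨A₀, rfl, hA₀⟩ := hA.exists_isSymplecticSqrt hα hs hA2 hAent
  obtain ⟨B₀, rfl, hB₀⟩ := hB.exists_isSymplecticSqrt hα hs hB2 hBent
  have hα' : ∀ c : k, c * c ≠ α⁻¹ := fun c hc => by
    have h₁ : s ^ 2 = (algebraMap k K c⁻¹) ^ 2 := by
      rw [hs, ← map_pow, inv_pow, sq, hc, inv_inv]
    rcases sq_eq_sq_iff_eq_or_eq_neg.1 h₁ with h | h
    · exact hsk ⟨_, h.symm⟩
    · exact hsk ⟨-c⁻¹, by rw [h, map_neg]⟩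
  obtain ⟨f, hf, hfT⟩ := hB₀.exists_isometry hchar hα' hA₀ le_rfl
  obtain ⟨Q, rfl⟩ := Matrix.toLin'.surjective f
  have hQ : IsSymp Q := by
    refine Matrix.ext_iff_mulVec.2 fun w => dotProduct_eq _ _ fun v => ?_
    have hvw := hf v w
    simp only [Matrix.toLinearMap₂'_apply', Matrix.toLin'_apply] at hvw
    rw [dotProduct_comm, dotProduct_comm _ v, ← hvw, Matrix.mul_assoc, ← Matrix.mulVec_mulVec,
      ← Matrix.mulVec_mulVec, Matrix.dotProduct_mulVec v, Matrix.vecMul_transpose]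
  have hQAB : Q * B₀ = A₀ * Q := by
    refine Matrix.ext_iff_mulVec.2 fun v => ?_
    rw [← Matrix.mulVec_mulVec, ← Matrix.mulVec_mulVec]
    exact hfT v
  refine ⟨Q, hQ, ?_⟩
  have hdet : IsUnit (Q.map (algebraMap k K)).det := by
    have := hQ.isUnit_det.map (algebraMap k K)
    rwa [RingHom.map_det] at this
  rw [Matrix.mul_assoc, Matrix.smul_mul, ← Matrix.map_mul, ← hQAB, Matrix.map_mul,
    ← Matrix.mul_smul, Matrix.nonsing_inv_mul_cancel_left _ _ hdet]
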